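/- Exact energy identity for the first-order IEQ scheme: under the hypotheses of the first-order scheme (smooth ℤᵈ-periodic φⁿ, φ^{n+1}, μ, Uⁿ, U^{n+1} satisfying (φ^{n+1} − φⁿ)/δt = div(M(φⁿ)∇μ), μ = −ε²Δφ^{n+1} + U^{n+1}·H(φⁿ), and 2(U^{n+1} − Uⁿ) = H(φⁿ)(φ^{n+1} − φⁿ) pointwise on ℝᵈ, with δt > 0, M continuously differentiable, F continuously differentiable, F + B > 0, H = F'/√(F+B)), one has the identity (ε²/2)(‖∇φ^{n+1}‖² − ‖∇φⁿ‖² + ‖∇(φ^{n+1} − φⁿ)‖²) + (‖U^{n+1}‖² − ‖Uⁿ‖² + ‖U^{n+1} − Uⁿ‖²) = −δt ∫_Q M(φⁿ(x)) |∇μ(x)|² dx, where ‖g‖² denotes ∫_Q |g(x)|² dx. -/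

import Mathlib

open MeasureTheory Real

noncomputable section

/-- `ℝᵈ` as a Euclidean space. -/
abbrev Esp (d : ℕ) := EuclideanSpace ℝ (Fin d)

/-- The unit cell `Q = [0,1]^d`. -/
def unitCube (d : ℕ) : Set (Esp d) := {x | ∀ i, 0 ≤ x i ∧ x i ≤ 1}

/-- `ℤᵈ`-periodicity of a (scalar- or vector-valued) function on `ℝᵈ`. -/
def ZPer {d : ℕ} {α : Type*} (g : Esp d → α) : Prop :=
  ∀ (x : Esp d) (k : Fin d → ℤ),
    g (x + (WithLp.equiv 2 (Fin d → ℝ)).symm (fun i => (k i : ℝ))) = g x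

/-- Divergence of a vector field on `ℝᵈ`. -/
def pdiv {d : ℕ} (F : Esp d → Esp d) (x : Esp d) : ℝ :=
  ∑ i, fderiv ℝ (fun y => F y i) x (EuclideanSpace.single i 1)

/-- Laplacian of a scalar field on `ℝᵈ`. -/
def plap {d : ℕ} (f : Esp d → ℝ) (x : Esp d) : ℝ := pdiv (gradient f) x

/-- The unit cell is compact. -/
lemma isCompact_unitCube (d : ℕ) : IsCompact (unitCube d) := by
  have h : unitCube d = WithLp.toLp 2 '' (Set.Icc (0 : Fin d → ℝ) 1) := by
    ext x
    constructor
    · intro hx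
      exact ⟨WithLp.ofLp x, ⟨fun i => (hx i).1, fun i => (hx i).2⟩, rfl⟩
    · rintro ⟨y, hy, rfl⟩ i
      exact ⟨hy.1 i, hy.2 i⟩
  rw [h]
  exact isCompact_Icc.image (PiLp.continuous_toLp 2 _)

lemma Continuous.integrableOn_unitCube {d : ℕ} {f : Esp d → ℝ} (hf : Continuous f) :
    IntegrableOn f (unitCube d) :=
  hf.continuousOn.integrableOn_compact (isCompact_unitCube d)

lemma contDiff_coord {d : ℕ} {n : WithTop ℕ∞} {V : Esp d → Esp d} (hV : ContDiff ℝ n V)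
    (i : Fin d) : ContDiff ℝ n fun y => V y i :=
  (contDiff_piLp 2).1 hV i

lemma continuous_pdiv {d : ℕ} {V : Esp d → Esp d} (hV : ContDiff ℝ 1 V) :
    Continuous (pdiv V) := by
  refine continuous_finsetSum _ fun i _ => ?_
  exact ((contDiff_coord hV i).continuous_fderiv one_ne_zero).clm_apply continuous_const

/-- The divergence of a `C¹` periodic vector field integrates to zero over the unit cell. -/
lemma integral_pdiv_eq_zero {d : ℕ} {V : Esp d → Esp d} (hV : ContDiff ℝ 1 V) (hp : ZPer V) :
    ∫ x in unitCube d, pdiv V x = 0 := by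
  cases d with
  | zero => simp [pdiv]
  | succ n =>
    have hpre : WithLp.toLp 2 ⁻¹' unitCube (n + 1) = Set.Icc (0 : Fin (n + 1) → ℝ) 1 := by
      ext y
      exact ⟨fun h => ⟨fun i => (h i).1, fun i => (h i).2⟩, fun h i => ⟨h.1 i, h.2 i⟩⟩
    have hemb : MeasurableEmbedding (WithLp.toLp 2 : (Fin (n + 1) → ℝ) → Esp (n + 1)) :=
      (MeasurableEquiv.toLp 2 (Fin (n + 1) → ℝ)).measurableEmbedding
    rw [← (PiLp.volume_preserving_toLp (Fin (n + 1))).setIntegral_preimage_emb hemb, hpre]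
    let L : (Fin (n + 1) → ℝ) →L[ℝ] Esp (n + 1) :=
      ((EuclideanSpace.equiv (Fin (n + 1)) ℝ).symm : (Fin (n + 1) → ℝ) →L[ℝ] Esp (n + 1))
    have hL : ∀ y, L y = WithLp.toLp 2 y := fun y => rfl
    have key := integral_divergence_of_hasFDerivAt_off_countable' (E := ℝ)
      (0 : Fin (n + 1) → ℝ) 1 zero_le_one
      (fun i y => V (L y) i)
      (fun i y => (fderiv ℝ (fun z => V z i) (L y)) ∘L L) ∅ Set.countable_empty
      (fun i => ((contDiff_coord hV i).continuous.comp L.continuous).continuousOn)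
      (fun y _ i => (((contDiff_coord hV i).differentiable one_ne_zero) (L y)).hasFDerivAt.comp y
        L.hasFDerivAt)
      (((continuous_pdiv hV).comp L.continuous).continuousOn.integrableOn_compact isCompact_Icc)
    refine key.trans (Finset.sum_eq_zero fun i _ => ?_)
    rw [sub_eq_zero]
    congr 1
    funext x
    have hk := hp (L (i.insertNth (0 : ℝ) x)) (Pi.single i 1)
    have harg : L (i.insertNth (0 : ℝ) x) +
        (WithLp.equiv 2 (Fin (n + 1) → ℝ)).symm (fun j => ((Pi.single i 1 : Fin (n + 1) → ℤ) j : ℝ))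
          = L (i.insertNth (1 : ℝ) x) := by
      ext j
      refine Fin.succAboveCases i ?_ (fun j => ?_) j <;> simp [hL]
    rw [harg] at hk
    exact congrArg (fun v : Esp (n + 1) => v i) hk

lemma gradient_apply_eq_fderiv_single {d : ℕ} (f : Esp d → ℝ) (x : Esp d) (i : Fin d) :
    gradient f x i = fderiv ℝ f x (EuclideanSpace.single i 1) := by
  rw [← inner_gradient_left, EuclideanSpace.inner_single_right]
  simp

lemma contDiff_gradient {d : ℕ} {f : Esp d → ℝ} (hf : ContDiff ℝ (⊤ : ℕ∞) f) :
    ContDiff ℝ 1 (gradient f) := by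
  have h : ContDiff ℝ 1 (fderiv ℝ f) := hf.fderiv_right (by norm_cast)
  exact (InnerProductSpace.toDual ℝ (Esp d)).symm.toContinuousLinearEquiv.contDiff.comp h

lemma ZPer.gradient {d : ℕ} {f : Esp d → ℝ} (hf : ZPer f) : ZPer (gradient f) := by
  intro x k
  have h : (fun y => f (y + (WithLp.equiv 2 (Fin d → ℝ)).symm (fun i => (k i : ℝ)))) = f :=
    funext fun y => hf y k
  rw [_root_.gradient, _root_.gradient, ← fderiv_comp_add_right, h]

lemma gradient_fun_sub {d : ℕ} {f g : Esp d → ℝ} {x : Esp d} (hf : DifferentiableAt ℝ f x)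
    (hg : DifferentiableAt ℝ g x) :
    gradient (fun y => f y - g y) x = gradient f x - gradient g x := by
  simp only [gradient, fderiv_fun_sub hf hg, map_sub]

/-- Product rule for the divergence. -/
lemma pdiv_smul {d : ℕ} {f : Esp d → ℝ} {V : Esp d → Esp d} (hf : ContDiff ℝ 1 f)
    (hV : ContDiff ℝ 1 V) (x : Esp d) :
    pdiv (fun y => f y • V y) x = f x * pdiv V x + inner ℝ (gradient f x) (V x) := by
  have h : ∀ i, fderiv ℝ (fun y => (f y • V y) i) x (EuclideanSpace.single i 1)
      = f x * fderiv ℝ (fun y => V y i) x (EuclideanSpace.single i 1)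
        + inner ℝ (gradient f x i) (V x i) := by
    intro i
    have h1 := hf.differentiable one_ne_zero x
    have h2 := (contDiff_coord hV i).differentiable one_ne_zero x
    have h3 : (fun y => (f y • V y) i) = fun y => f y * V y i := rfl
    rw [h3, fderiv_fun_mul h1 h2, gradient_apply_eq_fderiv_single]
    simp
  simp only [pdiv, h, Finset.sum_add_distrib, Finset.mul_sum, PiLp.inner_apply]

/-- Integration by parts over the unit cell for periodic functions. -/
lemma integral_mul_pdiv {d : ℕ} {f : Esp d → ℝ} {V : Esp d → Esp d} (hf : ContDiff ℝ 1 f)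
    (hV : ContDiff ℝ 1 V) (hfp : ZPer f) (hVp : ZPer V) :
    ∫ x in unitCube d, f x * pdiv V x = -∫ x in unitCube d, inner ℝ (gradient f x) (V x) := by
  have h0 : ∫ x in unitCube d, pdiv (fun y => f y • V y) x = 0 :=
    integral_pdiv_eq_zero (hf.smul hV) fun x k => by simp only [hfp x k, hVp x k]
  have hg : Continuous (gradient f) :=
    (InnerProductSpace.toDual ℝ (Esp d)).symm.continuous.comp (hf.continuous_fderiv one_ne_zero)
  simp only [pdiv_smul hf hV] at h0
  have i1 : IntegrableOn (fun x => f x * pdiv V x) (unitCube d) :=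
    (hf.continuous.mul (continuous_pdiv hV)).integrableOn_unitCube
  have i2 : IntegrableOn (fun x => inner ℝ (gradient f x) (V x)) (unitCube d) :=
    (hg.inner hV.continuous).integrableOn_unitCube
  rw [integral_add i1 i2] at h0
  linarith

/-- Exact energy identity for the first-order IEQ scheme. -/
theorem first_order_ieq_energy_identity (d : ℕ) (hd : 1 ≤ d)
    (ε δt B : ℝ) (hδt : 0 < δt)
    (F : ℝ → ℝ) (hF : ContDiff ℝ 1 F) (hFB : ∀ s : ℝ, 0 < F s + B)
    (H : ℝ → ℝ) (hH : ∀ s : ℝ, H s = deriv F s / Real.sqrt (F s + B))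
    (M : ℝ → ℝ) (hM : ContDiff ℝ 1 M)
    (φ0 φ1 μ U0 U1 : Esp d → ℝ)
    (hφ0 : ContDiff ℝ (⊤ : ℕ∞) φ0) (hφ1 : ContDiff ℝ (⊤ : ℕ∞) φ1) (hμ : ContDiff ℝ (⊤ : ℕ∞) μ)
    (hU0 : ContDiff ℝ (⊤ : ℕ∞) U0) (hU1 : ContDiff ℝ (⊤ : ℕ∞) U1)
    (hpφ0 : ZPer φ0) (hpφ1 : ZPer φ1) (hpμ : ZPer μ)
    (hpU0 : ZPer U0) (hpU1 : ZPer U1)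
    (heq1 : ∀ x : Esp d,
      (φ1 x - φ0 x) / δt = pdiv (fun y => M (φ0 y) • gradient μ y) x)
    (heq2 : ∀ x : Esp d, μ x = -ε ^ 2 * plap φ1 x + U1 x * H (φ0 x))
    (heq3 : ∀ x : Esp d, 2 * (U1 x - U0 x) = H (φ0 x) * (φ1 x - φ0 x)) :
    ε ^ 2 / 2 * ((∫ x in unitCube d, ‖gradient φ1 x‖ ^ 2)
        - (∫ x in unitCube d, ‖gradient φ0 x‖ ^ 2)
        + ∫ x in unitCube d, ‖gradient (fun y => φ1 y - φ0 y) x‖ ^ 2)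
      + ((∫ x in unitCube d, (U1 x) ^ 2) - (∫ x in unitCube d, (U0 x) ^ 2)
        + ∫ x in unitCube d, (U1 x - U0 x) ^ 2)
      = -δt * ∫ x in unitCube d, M (φ0 x) * ‖gradient μ x‖ ^ 2 := by
  have hle : (1 : WithTop ℕ∞) ≤ ((⊤ : ℕ∞) : WithTop ℕ∞) := by norm_cast
  have hψ : ContDiff ℝ 1 fun y => φ1 y - φ0 y := (hφ1.sub hφ0).of_le hle
  have hψp : ZPer fun y => φ1 y - φ0 y := fun x k => by simp only [hpφ0 x k, hpφ1 x k]
  have hG0 := contDiff_gradient hφ0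
  have hG1 := contDiff_gradient hφ1
  have hGμ := contDiff_gradient hμ
  have hMφ : ContDiff ℝ 1 fun y => M (φ0 y) := hM.comp (hφ0.of_le hle)
  have hflux : ContDiff ℝ 1 fun y => M (φ0 y) • gradient μ y := hMφ.smul hGμ
  have hfluxp : ZPer fun y => M (φ0 y) • gradient μ y := fun x k => by
    simp only [hpφ0 x k, hpμ.gradient x k]
  have hgψ : ∀ x, gradient (fun y => φ1 y - φ0 y) x = gradient φ1 x - gradient φ0 x := fun x =>
    gradient_fun_sub (hφ1.differentiable (by simp) x) (hφ0.differentiable (by simp) x)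
  have ibp1 := integral_mul_pdiv (hμ.of_le hle) hflux hpμ hfluxp
  have ibp2 := integral_mul_pdiv hψ hG1 hψp hpφ1.gradient
  have hdiss : ∀ x, inner ℝ (gradient μ x) (M (φ0 x) • gradient μ x)
      = M (φ0 x) * ‖gradient μ x‖ ^ 2 := fun x => by
    rw [inner_smul_right, real_inner_self_eq_norm_sq]
  simp only [hdiss] at ibp1
  have hsplit : ∀ x, δt * (μ x * pdiv (fun y => M (φ0 y) • gradient μ y) x)
      = -ε ^ 2 * ((φ1 x - φ0 x) * pdiv (gradient φ1) x)
        + (U1 x ^ 2 - U0 x ^ 2 + (U1 x - U0 x) ^ 2) := fun x => by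
    rw [← heq1 x]
    have h2 := heq2 x
    rw [plap] at h2
    have h4 : δt * (μ x * ((φ1 x - φ0 x) / δt)) = μ x * (φ1 x - φ0 x) := by field_simp
    rw [h4, h2]
    linear_combination (-U1 x) * heq3 x
  have hpol : ∀ x, inner ℝ (gradient (fun y => φ1 y - φ0 y) x) (gradient φ1 x)
      = 1 / 2 * (‖gradient φ1 x‖ ^ 2 - ‖gradient φ0 x‖ ^ 2
        + ‖gradient (fun y => φ1 y - φ0 y) x‖ ^ 2) := fun x => by
    rw [hgψ x, norm_sub_sq_real, inner_sub_left, real_inner_self_eq_norm_sq,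
      real_inner_comm (gradient φ1 x) (gradient φ0 x)]
    ring
  have c0 : IntegrableOn (fun x => ‖gradient φ0 x‖ ^ 2) (unitCube d) :=
    (hG0.continuous.norm.pow 2).integrableOn_unitCube
  have c1 : IntegrableOn (fun x => ‖gradient φ1 x‖ ^ 2) (unitCube d) :=
    (hG1.continuous.norm.pow 2).integrableOn_unitCube
  have cψ : IntegrableOn (fun x => ‖gradient (fun y => φ1 y - φ0 y) x‖ ^ 2) (unitCube d) := by
    simp only [hgψ]
    exact ((hG1.continuous.sub hG0.continuous).norm.pow 2).integrableOn_unitCube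
  have u0 : IntegrableOn (fun x => U0 x ^ 2) (unitCube d) :=
    (hU0.continuous.pow 2).integrableOn_unitCube
  have u1 : IntegrableOn (fun x => U1 x ^ 2) (unitCube d) :=
    (hU1.continuous.pow 2).integrableOn_unitCube
  have uδ : IntegrableOn (fun x => (U1 x - U0 x) ^ 2) (unitCube d) :=
    ((hU1.continuous.sub hU0.continuous).pow 2).integrableOn_unitCube
  have clap : IntegrableOn (fun x => (φ1 x - φ0 x) * pdiv (gradient φ1) x) (unitCube d) :=
    (hψ.continuous.mul (continuous_pdiv hG1)).integrableOn_unitCube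
  have c10 : IntegrableOn (fun x => ‖gradient φ1 x‖ ^ 2 - ‖gradient φ0 x‖ ^ 2) (unitCube d) :=
    c1.sub c0
  have u10 : IntegrableOn (fun x => U1 x ^ 2 - U0 x ^ 2) (unitCube d) := u1.sub u0
  have uS : IntegrableOn (fun x => U1 x ^ 2 - U0 x ^ 2 + (U1 x - U0 x) ^ 2) (unitCube d) :=
    u10.add uδ
  have hI : δt * ∫ x in unitCube d, μ x * pdiv (fun y => M (φ0 y) • gradient μ y) x
      = -ε ^ 2 * (∫ x in unitCube d, (φ1 x - φ0 x) * pdiv (gradient φ1) x)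
        + ((∫ x in unitCube d, U1 x ^ 2) - (∫ x in unitCube d, U0 x ^ 2)
          + ∫ x in unitCube d, (U1 x - U0 x) ^ 2) := by
    rw [← integral_const_mul, ← integral_const_mul, ← integral_sub u1 u0,
      ← integral_add u10 uδ, ← integral_add (clap.const_mul _) uS]
    exact integral_congr_ae (Filter.Eventually.of_forall hsplit)
  have hJ : ∫ x in unitCube d, inner ℝ (gradient (fun y => φ1 y - φ0 y) x) (gradient φ1 x)
      = 1 / 2 * ((∫ x in unitCube d, ‖gradient φ1 x‖ ^ 2)
        - (∫ x in unitCube d, ‖gradient φ0 x‖ ^ 2)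
        + ∫ x in unitCube d, ‖gradient (fun y => φ1 y - φ0 y) x‖ ^ 2) := by
    rw [← integral_sub c1 c0, ← integral_add c10 cψ, ← integral_const_mul]
    exact integral_congr_ae (Filter.Eventually.of_forall hpol)
  rw [ibp1, ibp2, hJ] at hI
  linear_combination -hI
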